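/- arXiv:2212.00354 — 5 statements merged into one kernel-verified Lean document; each statement's English description precedes it below -/
import Mathlib

section
/- Let N ∈ ℕ, let C ∈ ℝ^{N×N}, let θ, η ∈ ℝ^{N×N} satisfy 0 ≤ θ_ij ≤ η_ij for all i,j, let u, v ∈ ℝ^N with Σ_i u_i = Σ_j v_j = 1, and suppose k_θ := 1 − Σ_{i,j} θ_ij > 0. Define C' = k_θ C, η'_ij = (η_ij − θ_ij)/k_θ, u'_i = (u_i − Σ_j θ_ij)/k_θ, v'_j = (v_j − Σ_i θ_ij)/k_θ. Let F = {γ : θ_ij ≤ γ_ij ≤ η_ij, Σ_j γ_ij = u_i, Σ_i γ_ij = v_j} and F' = {γ' : 0 ≤ γ'_ij ≤ η'_ij, Σ_j γ'_ij = u'_i, Σ_i γ'_ij = v'_j}. Then γ* minimizes ⟨C, γ⟩ over F if and only if (γ* − θ)/k_θ minimizes ⟨C', γ'⟩ over F'. -/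
/-- Lemma 2.1 (first half): under the affine substitution `γ' = (γ - θ)/k_θ`,
`γ*` minimizes `⟨C, γ⟩` over the feasible set with lower bound `θ` iff
`(γ* - θ)/k_θ` minimizes `⟨C', γ'⟩` over the feasible set with zero lower bound. -/
theorem COT_lower_bound_equivalence
    (N : ℕ) (C θ η : Fin N → Fin N → ℝ) (u v : Fin N → ℝ)
    (hθη : ∀ i j, 0 ≤ θ i j ∧ θ i j ≤ η i j)
    (hu : ∑ i, u i = 1) (hv : ∑ j, v j = 1)
    (kθ : ℝ) (hkθ : kθ = 1 - ∑ i, ∑ j, θ i j) (hkθpos : 0 < kθ)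
    (C' : Fin N → Fin N → ℝ) (hC' : ∀ i j, C' i j = kθ * C i j)
    (η' : Fin N → Fin N → ℝ) (hη' : ∀ i j, η' i j = (η i j - θ i j) / kθ)
    (u' : Fin N → ℝ) (hu' : ∀ i, u' i = (u i - ∑ j, θ i j) / kθ)
    (v' : Fin N → ℝ) (hv' : ∀ j, v' j = (v j - ∑ i, θ i j) / kθ)
    (F : Set (Fin N → Fin N → ℝ))
    (hF : F = {γ | (∀ i j, θ i j ≤ γ i j ∧ γ i j ≤ η i j) ∧
      (∀ i, ∑ j, γ i j = u i) ∧ (∀ j, ∑ i, γ i j = v j)})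
    (F' : Set (Fin N → Fin N → ℝ))
    (hF' : F' = {γ' | (∀ i j, 0 ≤ γ' i j ∧ γ' i j ≤ η' i j) ∧
      (∀ i, ∑ j, γ' i j = u' i) ∧ (∀ j, ∑ i, γ' i j = v' j)})
    (γstar : Fin N → Fin N → ℝ) :
    (γstar ∈ F ∧ ∀ γ ∈ F, ∑ i, ∑ j, C i j * γstar i j ≤ ∑ i, ∑ j, C i j * γ i j)
    ↔
    ((fun i j => (γstar i j - θ i j) / kθ) ∈ F' ∧
      ∀ γ' ∈ F', ∑ i, ∑ j, C' i j * ((γstar i j - θ i j) / kθ)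
        ≤ ∑ i, ∑ j, C' i j * γ' i j) := by
  have hk : kθ ≠ 0 := hkθpos.ne'
  have hmem : ∀ γ : Fin N → Fin N → ℝ, γ ∈ F ↔ (fun i j => (γ i j - θ i j) / kθ) ∈ F' := by
    intro γ
    rw [hF, hF']
    simp only [Set.mem_ofPred_eq, hη', hu', hv', ← Finset.sum_div, Finset.sum_sub_distrib,
      div_left_inj' hk, sub_left_inj, sub_le_sub_iff_right,
      le_div_iff₀ hkθpos, zero_mul, sub_nonneg, div_mul_cancel₀ _ hk]
  have hobj : ∀ γ : Fin N → Fin N → ℝ, ∑ i, ∑ j, C' i j * ((γ i j - θ i j) / kθ)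
      = ∑ i, ∑ j, C i j * γ i j - ∑ i, ∑ j, C i j * θ i j := by
    intro γ
    simp only [← Finset.sum_sub_distrib]
    refine Finset.sum_congr rfl fun i _ => Finset.sum_congr rfl fun j _ => ?_
    rw [hC']
    field_simp
  rw [← hmem, hobj]
  refine and_congr_right fun _ => ⟨fun h γ' hγ' => ?_, fun h γ hγ => ?_⟩
  · have e : (fun i j => ((kθ * γ' i j + θ i j) - θ i j) / kθ) = γ' := by
      funext i j
      field_simp
      ring
    have h1 := h (fun i j => kθ * γ' i j + θ i j) ((hmem _).2 (by rw [e]; exact hγ'))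
    have h2 := hobj (fun i j => kθ * γ' i j + θ i j)
    have h3 : ∀ i j, ((kθ * γ' i j + θ i j) - θ i j) / kθ = γ' i j :=
      fun i j => congrFun (congrFun e i) j
    simp only [h3] at h2
    linarith
  · have h1 := h _ ((hmem γ).1 hγ)
    rw [hobj] at h1
    linarith
end

section
/- Let N ∈ ℕ, C ∈ ℝ^{N×N}, ε > 0, let θ, η ∈ ℝ^{N×N} satisfy 0 ≤ θ_ij ≤ η_ij for all i,j, let u, v ∈ ℝ^N with Σ_i u_i = Σ_j v_j = 1, and suppose k_θ := 1 − Σ_{i,j} θ_ij > 0. Define C' = k_θ C, ε' = k_θ ε, η'_ij = (η_ij − θ_ij)/k_θ, u'_i = (u_i − Σ_j θ_ij)/k_θ, v'_j = (v_j − Σ_i θ_ij)/k_θ. Then for every γ with θ_ij ≤ γ_ij ≤ η_ij for all i,j, writing γ' = (γ − θ)/k_θ, the following identity holds (with the convention 0·ln 0 = 0): ⟨C,γ⟩ + ε Σ_{i,j} (γ_ij − θ_ij) ln(γ_ij − θ_ij) + ε Σ_{i,j} (η_ij − γ_ij) ln(η_ij − γ_ij) = ⟨C',γ'⟩ + ε'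 Σ_{i,j} γ'_ij ln γ'_ij + ε' Σ_{i,j} (η'_ij − γ'_ij) ln(η'_ij − γ'_ij) + ⟨C,θ⟩ + ε' (ln k_θ) Σ_{i,j} η'_ij. Consequently, γ minimizes the double regularized objective with lower bound θ over F = {γ : θ ⪯ γ ⪯ η, Σ_j γ_ij = u_i, Σ_i γ_ij = v_j} if and only if γ' = (γ − θ)/k_θ minimizes the double regularized objective with zero lower bound (cost C', parameter ε', upper bound η') over F' = {γ' : 0 ⪯ γ' ⪯ η', Σ_j γ'_ij = u'_i, Σ_i γ'_ij = v'_j}. -/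
/-- Lemma 2.1 (second half): the double regularized objective with general lower
bound `θ` equals, under the substitution `γ' = (γ - θ)/k_θ`, the double regularized
objective with zero lower bound (cost `C' = k_θ C`, parameter `ε' = k_θ ε`, upper
bound `η'`) plus the additive constant `⟨C, θ⟩ + ε' (ln k_θ) Σ η'`; consequently the
two regularized problems have the same minimizers under this substitution. -/
theorem double_regularized_equivalence
    (N : ℕ) (C θ η : Fin N → Fin N → ℝ) (ε : ℝ) (hε : 0 < ε) (u v : Fin N → ℝ)
    (hθη : ∀ i j, 0 ≤ θ i j ∧ θ i j ≤ η i j)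
    (hu : ∑ i, u i = 1) (hv : ∑ j, v j = 1)
    (kθ : ℝ) (hkθ : kθ = 1 - ∑ i, ∑ j, θ i j) (hkθpos : 0 < kθ)
    (C' : Fin N → Fin N → ℝ) (hC' : ∀ i j, C' i j = kθ * C i j)
    (ε' : ℝ) (hε' : ε' = kθ * ε)
    (η' : Fin N → Fin N → ℝ) (hη' : ∀ i j, η' i j = (η i j - θ i j) / kθ)
    (u' : Fin N → ℝ) (hu' : ∀ i, u' i = (u i - ∑ j, θ i j) / kθ)
    (v' : Fin N → ℝ) (hv' : ∀ j, v' j = (v j - ∑ i, θ i j) / kθ)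
    -- the two objectives (with the convention `Real.log 0 = 0`, so `0 · ln 0 = 0`)
    (J J' : (Fin N → Fin N → ℝ) → ℝ)
    (hJ : ∀ γ, J γ = (∑ i, ∑ j, C i j * γ i j)
      + ε * ∑ i, ∑ j, (γ i j - θ i j) * Real.log (γ i j - θ i j)
      + ε * ∑ i, ∑ j, (η i j - γ i j) * Real.log (η i j - γ i j))
    (hJ' : ∀ γ', J' γ' = (∑ i, ∑ j, C' i j * γ' i j)
      + ε' * ∑ i, ∑ j, γ' i j * Real.log (γ' i j)
      + ε' * ∑ i, ∑ j, (η' i j - γ' i j) * Real.log (η' i j - γ' i j))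
    (F : Set (Fin N → Fin N → ℝ))
    (hF : F = {γ | (∀ i j, θ i j ≤ γ i j ∧ γ i j ≤ η i j) ∧
      (∀ i, ∑ j, γ i j = u i) ∧ (∀ j, ∑ i, γ i j = v j)})
    (F' : Set (Fin N → Fin N → ℝ))
    (hF' : F' = {γ' | (∀ i j, 0 ≤ γ' i j ∧ γ' i j ≤ η' i j) ∧
      (∀ i, ∑ j, γ' i j = u' i) ∧ (∀ j, ∑ i, γ' i j = v' j)}) :
    (∀ γ : Fin N → Fin N → ℝ, (∀ i j, θ i j ≤ γ i j ∧ γ i j ≤ η i j) →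
      J γ = J' (fun i j => (γ i j - θ i j) / kθ)
        + (∑ i, ∑ j, C i j * θ i j) + ε' * Real.log kθ * ∑ i, ∑ j, η' i j)
    ∧
    (∀ γ : Fin N → Fin N → ℝ,
      (γ ∈ F ∧ ∀ σ ∈ F, J γ ≤ J σ)
      ↔
      ((fun i j => (γ i j - θ i j) / kθ) ∈ F' ∧
        ∀ σ' ∈ F', J' (fun i j => (γ i j - θ i j) / kθ) ≤ J' σ')) := by
  have hk : kθ ≠ 0 := hkθpos.ne'
  have hx : ∀ x : ℝ, x * Real.log x
      = kθ * ((x / kθ) * Real.log (x / kθ)) + x * Real.log kθ := by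
    intro x
    by_cases h : x = 0
    · simp [h]
    · rw [Real.log_div h hk]
      field_simp
      ring
  have key : ∀ γ : Fin N → Fin N → ℝ,
      J γ = J' (fun i j => (γ i j - θ i j) / kθ)
        + (∑ i, ∑ j, C i j * θ i j) + ε' * Real.log kθ * ∑ i, ∑ j, η' i j := by
    intro γ
    rw [hJ, hJ']
    simp only [Finset.mul_sum, ← Finset.sum_add_distrib]
    refine Finset.sum_congr rfl fun i _ => Finset.sum_congr rfl fun j _ => ?_
    have e : η' i j - (γ i j - θ i j) / kθ = (η i j - γ i j) / kθ := by
      rw [hη']; ring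
    rw [e, hx (γ i j - θ i j), hx (η i j - γ i j), hC', hε', hη']
    have e1 : kθ * C i j * ((γ i j - θ i j) / kθ) = C i j * (γ i j - θ i j) := by
      field_simp
    have e2 : kθ * ε * Real.log kθ * ((η i j - θ i j) / kθ)
        = ε * Real.log kθ * (η i j - θ i j) := by
      field_simp
    rw [e1, e2]
    ring
  have mem : ∀ γ : Fin N → Fin N → ℝ,
      γ ∈ F ↔ (fun i j => (γ i j - θ i j) / kθ) ∈ F' := by
    intro γ
    rw [hF, hF']
    simp only [Set.mem_ofPred_eq, hη', hu', hv', ← Finset.sum_div, Finset.sum_sub_distrib,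
      div_left_inj' hk, sub_left_inj, div_mul_cancel₀ _ hk,
      sub_le_sub_iff_right, le_div_iff₀ hkθpos, zero_mul, sub_nonneg]
  refine ⟨fun γ _ => key γ, fun γ => and_congr (mem γ) ⟨fun h σ' hσ' => ?_, fun h σ hσ => ?_⟩⟩
  · have e : (fun i j => ((fun i j => kθ * σ' i j + θ i j) i j - θ i j) / kθ) = σ' := by
      funext i j
      field_simp
      ring
    have h1 := h (fun i j => kθ * σ' i j + θ i j) ((mem _).2 (by rw [e]; exact hσ'))
    rw [key γ, key (fun i j => kθ * σ' i j + θ i j), e] at h1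
    linarith
  · have h1 := h _ ((mem σ).1 hσ)
    rw [key γ, key σ]
    linarith
end

section
/- Let N ∈ ℕ, C ∈ ℝ^{N×N}, η ∈ ℝ^{N×N} with nonnegative entries, and u, v ∈ ℝ^N, and let F = Π(u,v) ∩ S_{0η} = {γ : 0 ≤ γ_ij ≤ η_ij, Σ_j γ_ij = u_i, Σ_i γ_ij = v_j} be nonempty. Let (ε_k) be a sequence of positive reals with ε_k → 0, and for each k let γ_k minimize ⟨C,γ⟩ + ε_k E_η(γ) over F, where E_η(γ) = Σ_{i,j} γ_ij ln γ_ij + Σ_{i,j} (η_ij − γ_ij) ln(η_ij − γ_ij) (with the convention 0·ln 0 = 0). If γ_k converges to some matrix γ̂, then γ̂ ∈ F and ⟨C, γ̂⟩ = min_{γ ∈ F} ⟨C, γ⟩; that is, every limit point of the regularized optimal solutions is an optimal solution of the capacity constrained optimal transport problem. -/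
/-- Convergence assertion of Theorem 2.1: if `ε_k → 0`, `γ_k` minimizes the
regularized objective over the feasible set `F`, and `γ_k → γ̂`, then `γ̂ ∈ F`
and `γ̂` minimizes the unregularized cost `⟨C, ·⟩` over `F`
(convention `0 · ln 0 = 0`, automatic since `Real.log 0 = 0`). -/
theorem limit_point_is_optimal
    (N : ℕ) (C η : Fin N → Fin N → ℝ) (hη : ∀ i j, 0 ≤ η i j) (u v : Fin N → ℝ)
    (F : Set (Fin N → Fin N → ℝ))
    (hF : F = {γ | (∀ i j, 0 ≤ γ i j ∧ γ i j ≤ η i j) ∧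
      (∀ i, ∑ j, γ i j = u i) ∧ (∀ j, ∑ i, γ i j = v j)})
    (hFne : F.Nonempty)
    (E : (Fin N → Fin N → ℝ) → ℝ)
    (hE : ∀ γ, E γ = (∑ i, ∑ j, γ i j * Real.log (γ i j))
      + ∑ i, ∑ j, (η i j - γ i j) * Real.log (η i j - γ i j))
    (ε : ℕ → ℝ) (hεpos : ∀ k, 0 < ε k)
    (hεlim : Filter.Tendsto ε Filter.atTop (nhds 0))
    (γseq : ℕ → (Fin N → Fin N → ℝ))
    (hγseq : ∀ k, γseq k ∈ F ∧ ∀ γ ∈ F,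
      (∑ i, ∑ j, C i j * γseq k i j) + ε k * E (γseq k)
        ≤ (∑ i, ∑ j, C i j * γ i j) + ε k * E γ)
    (γhat : Fin N → Fin N → ℝ)
    (hlim : Filter.Tendsto γseq Filter.atTop (nhds γhat)) :
    γhat ∈ F ∧ ∀ γ ∈ F, ∑ i, ∑ j, C i j * γhat i j ≤ ∑ i, ∑ j, C i j * γ i j := by
  have hEc : Continuous E := by
    have hE' : E = fun γ => (∑ i, ∑ j, γ i j * Real.log (γ i j))
      + ∑ i, ∑ j, (η i j - γ i j) * Real.log (η i j - γ i j) := funext hE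
    rw [hE']
    refine Continuous.add ?_ ?_
    · refine continuous_finsetSum _ fun i _ => continuous_finsetSum _ fun j _ => ?_
      exact Real.continuous_mul_log.comp (f := fun γ : Fin N → Fin N → ℝ => γ i j) (by fun_prop)
    · refine continuous_finsetSum _ fun i _ => continuous_finsetSum _ fun j _ => ?_
      exact Real.continuous_mul_log.comp
        (f := fun γ : Fin N → Fin N → ℝ => η i j - γ i j) (by fun_prop)
  have hCc : Continuous fun γ : Fin N → Fin N → ℝ => ∑ i, ∑ j, C i j * γ i j := by
    fun_prop
  have hclosed : IsClosed F := by
    rw [hF]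
    simp only [Set.setOf_and, Set.setOf_forall]
    refine IsClosed.inter ?_ (IsClosed.inter ?_ ?_)
    · refine isClosed_iInter fun i => isClosed_iInter fun j => IsClosed.inter ?_ ?_
      · exact isClosed_le (by fun_prop) (by fun_prop)
      · exact isClosed_le (by fun_prop) (by fun_prop)
    · exact isClosed_iInter fun i => isClosed_eq (by fun_prop) (by fun_prop)
    · exact isClosed_iInter fun i => isClosed_eq (by fun_prop) (by fun_prop)
  refine ⟨hclosed.mem_of_tendsto hlim (Filter.Eventually.of_forall fun k => (hγseq k).1), ?_⟩
  intro γ hγ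
  have h1 := ((hCc.tendsto γhat).comp hlim).add (hεlim.mul ((hEc.tendsto γhat).comp hlim))
  have h2 := (tendsto_const_nhds (x := ∑ i, ∑ j, C i j * γ i j)
    (f := Filter.atTop (α := ℕ))).add (hεlim.mul_const (E γ))
  have h3 := le_of_tendsto_of_tendsto' h1 h2 fun k => (hγseq k).2 γ hγ
  simpa using h3
end

section
/- Let N ∈ ℕ, C ∈ ℝ^{N×N}, η ∈ ℝ^{N×N} with nonnegative entries, and u, v ∈ ℝ^N, and let F = Π(u,v) ∩ S_{0η} = {γ : 0 ≤ γ_ij ≤ η_ij, Σ_j γ_ij = u_i, Σ_i γ_ij = v_j} be nonempty. Let (ε_k) be a sequence of positive reals with ε_k → 0, and for each k let γ_k minimize ⟨C,γ⟩ + ε_k E_η(γ) over F, where E_η(γ) = Σ_{i,j} γ_ij ln γ_ij + Σ_{i,j} (η_ij − γ_ij) ln(η_ij − γ_ij) (with the convention 0·ln 0 = 0). Then the regularized costs converge to the optimal cost: ⟨C, γ_k⟩ → min_{γ ∈ F} ⟨C, γ⟩ as k → ∞. -/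
/-- Convergence of the regularized costs: if `ε_k → 0` and `γ_k` minimizes the
regularized objective over the nonempty feasible set `F`, then
`⟨C, γ_k⟩ → min_{γ ∈ F} ⟨C, γ⟩` (the optimal cost, expressed as the infimum of
the cost over `F`, which is attained since `F` is compact and nonempty).
Convention `0 · ln 0 = 0`, automatic since `Real.log 0 = 0`. -/
theorem regularized_costs_tendsto_optimal
    (N : ℕ) (C η : Fin N → Fin N → ℝ) (hη : ∀ i j, 0 ≤ η i j) (u v : Fin N → ℝ)
    (F : Set (Fin N → Fin N → ℝ))
    (hF : F = {γ | (∀ i j, 0 ≤ γ i j ∧ γ i j ≤ η i j) ∧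
      (∀ i, ∑ j, γ i j = u i) ∧ (∀ j, ∑ i, γ i j = v j)})
    (hFne : F.Nonempty)
    (E : (Fin N → Fin N → ℝ) → ℝ)
    (hE : ∀ γ, E γ = (∑ i, ∑ j, γ i j * Real.log (γ i j))
      + ∑ i, ∑ j, (η i j - γ i j) * Real.log (η i j - γ i j))
    (ε : ℕ → ℝ) (hεpos : ∀ k, 0 < ε k)
    (hεlim : Filter.Tendsto ε Filter.atTop (nhds 0))
    (γseq : ℕ → (Fin N → Fin N → ℝ))
    (hγseq : ∀ k, γseq k ∈ F ∧ ∀ γ ∈ F,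
      (∑ i, ∑ j, C i j * γseq k i j) + ε k * E (γseq k)
        ≤ (∑ i, ∑ j, C i j * γ i j) + ε k * E γ) :
    Filter.Tendsto (fun k => ∑ i, ∑ j, C i j * γseq k i j) Filter.atTop
      (nhds (sInf ((fun γ => ∑ i, ∑ j, C i j * γ i j) '' F))) := by
  have hcomp : IsCompact F := by
    have h1 : IsCompact (Set.Icc (0 : Fin N → Fin N → ℝ) η) := isCompact_Icc
    have h2 : IsClosed {γ : Fin N → Fin N → ℝ | (∀ i, ∑ j, γ i j = u i) ∧
        (∀ j, ∑ i, γ i j = v j)} := by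
      simp only [Set.setOf_and, Set.setOf_forall]
      refine IsClosed.inter (isClosed_iInter fun i => ?_) (isClosed_iInter fun j => ?_)
      · exact isClosed_eq (by fun_prop) continuous_const
      · exact isClosed_eq (by fun_prop) continuous_const
    have h3 := h1.inter_right h2
    convert h3 using 1
    rw [hF]
    ext γ
    simp only [Set.mem_setOf_eq, Set.mem_inter_iff, Set.mem_Icc, Pi.le_def, Pi.zero_apply,
      forall_and]
  have hEc : Continuous E := by
    have h0 : E = fun γ => (∑ i, ∑ j, γ i j * Real.log (γ i j))
        + ∑ i, ∑ j, (η i j - γ i j) * Real.log (η i j - γ i j) := funext hE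
    rw [h0]
    refine Continuous.add ?_ ?_
    · refine continuous_finsetSum _ fun i _ => continuous_finsetSum _ fun j _ => ?_
      exact Real.continuous_mul_log.comp (f := fun γ : Fin N → Fin N → ℝ => γ i j) (by fun_prop)
    · refine continuous_finsetSum _ fun i _ => continuous_finsetSum _ fun j _ => ?_
      exact Real.continuous_mul_log.comp
        (f := fun γ : Fin N → Fin N → ℝ => η i j - γ i j) (by fun_prop)
  have hCc : Continuous (fun γ : Fin N → Fin N → ℝ => ∑ i, ∑ j, C i j * γ i j) := by
    fun_prop
  obtain ⟨g, hgF, hg, hgmin⟩ := hcomp.exists_sInf_image_eq_and_le hFne hCc.continuousOn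
  obtain ⟨m, hmF, hm⟩ := hcomp.exists_isMinOn hFne hEc.continuousOn
  rw [hg]
  have hup : Filter.Tendsto (fun k => (∑ i, ∑ j, C i j * g i j) + ε k * (E g - E m))
      Filter.atTop (nhds (∑ i, ∑ j, C i j * g i j)) := by
    simpa using (hεlim.mul_const (E g - E m)).const_add (∑ i, ∑ j, C i j * g i j)
  refine tendsto_of_tendsto_of_tendsto_of_le_of_le tendsto_const_nhds hup ?_ ?_
  · intro k
    exact hgmin _ (hγseq k).1
  · intro k
    have h1 := (hγseq k).2 g hgF
    have h2 : E m ≤ E (γseq k) := hm (hγseq k).1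
    have h3 := mul_le_mul_of_nonneg_left h2 (hεpos k).le
    simp only [mul_sub]
    linarith
end

section
/- Let N ∈ ℕ, and let ψ, K, η ∈ ℝ^N satisfy ψ_j > 0 and K_j > 0 for all j and η_j ≥ 0 for all j. Let c ∈ ℝ satisfy 0 < c < Σ_{j=1}^N η_j, and define g : (0, ∞) → ℝ by g(φ) = Σ_{j=1}^N η_j / (1 + φ K_j ψ_j) − Σ_{j=1}^N η_j + c. Then there exists a unique φ* ∈ (0, ∞) with g(φ*) = 0. -/
/-- Existence and uniqueness of the zero of the dual-variable function
`g(φ) = Σ_j η_j/(1 + φ K_j ψ_j) - Σ_j η_j + c` on `(0, ∞)` when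
`0 < c < Σ_j η_j`; this makes each step of the Double Regularization Method
well defined. -/
theorem dual_function_unique_zero
    (N : ℕ) (ψ K η : Fin N → ℝ)
    (hψ : ∀ j, 0 < ψ j) (hK : ∀ j, 0 < K j) (hη : ∀ j, 0 ≤ η j)
    (c : ℝ) (hc : 0 < c) (hc' : c < ∑ j, η j)
    (g : ℝ → ℝ)
    (hg : ∀ φ, g φ = (∑ j, η j / (1 + φ * K j * ψ j)) - (∑ j, η j) + c) :
    ∃! φstar : ℝ, 0 < φstar ∧ g φstar = 0 := by
  have hden : ∀ φ, 0 ≤ φ → ∀ j, 0 < 1 + φ * K j * ψ j := by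
    intro φ h j
    have := mul_nonneg (mul_nonneg h (hK j).le) (hψ j).le
    linarith
  have hcont : ContinuousOn g (Set.Ici 0) := by
    rw [funext hg]
    refine ContinuousOn.add (ContinuousOn.sub ?_ continuousOn_const) continuousOn_const
    refine continuousOn_finsetSum _ fun j _ => ?_
    refine ContinuousOn.div continuousOn_const (by fun_prop) ?_
    intro x hx
    exact (hden x hx j).ne'
  have hpos : ∃ j, 0 < η j := by
    by_contra! h
    have : ∑ j, η j ≤ 0 := Finset.sum_nonpos fun j _ => h j
    linarith
  have hanti : StrictAntiOn g (Set.Ici 0) := by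
    intro x hx y hy hxy
    have hlt : ∀ j, 1 + x * K j * ψ j < 1 + y * K j * ψ j := by
      intro j
      have := mul_lt_mul_of_pos_right (mul_lt_mul_of_pos_right hxy (hK j)) (hψ j)
      linarith
    have : ∑ j, η j / (1 + y * K j * ψ j) < ∑ j, η j / (1 + x * K j * ψ j) := by
      obtain ⟨j₀, hj₀⟩ := hpos
      refine Finset.sum_lt_sum (fun j _ => ?_) ⟨j₀, Finset.mem_univ _, ?_⟩
      · exact div_le_div_of_nonneg_left (hη j) (hden x hx j) (hlt j).le
      · exact div_lt_div_of_pos_left hj₀ (hden x hx j₀) (hlt j₀)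
    rw [hg, hg]
    linarith
  have hlim : Filter.Tendsto g Filter.atTop (nhds (c - ∑ j, η j)) := by
    have h1 : Filter.Tendsto (fun φ : ℝ => ∑ j, η j / (1 + φ * K j * ψ j)) Filter.atTop
        (nhds (∑ _j : Fin N, (0 : ℝ))) := by
      refine tendsto_finsetSum _ fun j _ => ?_
      refine Filter.Tendsto.div_atTop tendsto_const_nhds ?_
      refine Filter.tendsto_atTop_add_const_left _ _ ?_
      exact (Filter.tendsto_id.atTop_mul_const (hK j)).atTop_mul_const (hψ j)
    rw [funext hg]
    have h2 := (h1.sub_const (∑ j, η j)).add_const c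
    convert h2 using 2
    simp
    ring
  have h0 : g 0 = c := by simp [hg]
  obtain ⟨M, hM, hM0⟩ := ((hlim.eventually_lt_const (show c - ∑ j, η j < 0 by linarith)).and
    (Filter.eventually_ge_atTop (0 : ℝ))).exists
  obtain ⟨z, hz, hgz⟩ := intermediate_value_Icc' hM0 (hcont.mono Set.Icc_subset_Ici_self)
    (show (0 : ℝ) ∈ Set.Icc (g M) (g 0) from ⟨hM.le, by rw [h0]; exact hc.le⟩)
  have hz0 : 0 < z := by
    refine lt_of_le_of_ne hz.1 ?_
    rintro rfl
    linarith
  refine ⟨z, ⟨hz0, hgz⟩, ?_⟩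
  rintro y ⟨hy, hgy⟩
  exact hanti.injOn (Set.mem_Ici.2 hy.le) (Set.mem_Ici.2 hz0.le) (hgy.trans hgz.symm)
end
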